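/- arXiv:2504.01497 — 4 statements merged into one kernel-verified Lean document; each statement's English description precedes it below -/
import Mathlib

section
/- Let X be a solution of the perturbed ODE. Then for every t ≥ 0, the Lyapunov function E is differentiable at t and satisfies E'(t)·e^{−√μ t} ≤ −(√μ/2)‖Ẋ_t‖² − (μ√μ/2)Δ₁‖X_t − x*‖² + Δ₂((√μ/2)Δ₂ − Δ₁)‖∇f(X_t)‖². -/
open Filter Topology in
/-- First-order lower bound for a differentiable strongly convex function. -/
theorem StrongConvexOn.add_inner_gradient_add_le
    {H : Type*} [NormedAddCommGroup H] [InnerProductSpace ℝ H] [CompleteSpace H]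
    {f : H → ℝ} {μ : ℝ} (hsc : StrongConvexOn Set.univ μ f) {x : H}
    (hf : DifferentiableAt ℝ f x) (y : H) :
    f x + inner ℝ (gradient f x) (y - x) + μ / 2 * ‖y - x‖ ^ 2 ≤ f y := by
  have hline : HasDerivAt (fun a : ℝ => x + a • (y - x)) (y - x) 0 := by
    simpa using ((hasDerivAt_id (0 : ℝ)).smul_const (y - x)).const_add x
  have hφ : HasDerivAt (fun a : ℝ => f (x + a • (y - x))) (inner ℝ (gradient f x) (y - x)) 0 := by
    have hg : HasFDerivAt f (InnerProductSpace.toDual ℝ H (gradient f x))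
        (x + (0 : ℝ) • (y - x)) := by
      simpa using hf.hasGradientAt.hasFDerivAt
    exact hg.comp_hasDerivAt (0 : ℝ) hline
  have hslope := hφ.tendsto_slope_zero_right
  have hbound : Tendsto (fun a : ℝ => f y - f x - (1 - a) * (μ / 2 * ‖y - x‖ ^ 2)) (𝓝[>] 0)
      (𝓝 (f y - f x - (1 - 0) * (μ / 2 * ‖y - x‖ ^ 2))) :=
    (Continuous.tendsto (by fun_prop) 0).mono_left nhdsWithin_le_nhds
  have hle := le_of_tendsto_of_tendsto hslope hbound (by
    filter_upwards [Ioo_mem_nhdsGT (zero_lt_one' ℝ)] with a ha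
    have h := hsc.2 (Set.mem_univ x) (Set.mem_univ y) (sub_nonneg.2 ha.2.le) ha.1.le (by ring)
    have hpt : (1 - a) • x + a • y = x + a • (y - x) := by module
    rw [hpt, norm_sub_rev] at h
    simp only [smul_eq_mul, zero_add, zero_smul, add_zero] at h ⊢
    rw [inv_mul_le_iff₀ ha.1]
    linarith)
  linarith

/-- derivative bound on the Lyapunov function along the perturbed ODE. -/
theorem lyapunov_deriv_bound
    {H : Type*} [NormedAddCommGroup H] [InnerProductSpace ℝ H] [FiniteDimensional ℝ H]
    (f : H → ℝ) (μ : ℝ) (hμ : 0 < μ)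
    (hf : ContDiff ℝ 2 f) (hsc : StrongConvexOn Set.univ μ f)
    (xs : H) (hmin : ∀ y, f xs ≤ f y)
    (Δ₁ Δ₂ : ℝ) (hΔ₁ : 0 ≤ Δ₁) (hΔ₂ : 0 ≤ Δ₂)
    (X V G : ℝ → H)
    (hX : ∀ t, HasDerivAt X (V t) t)
    (hG : ∀ t, HasDerivAt (fun τ => gradient f (X τ)) (G t) t)
    (hV : ∀ t, HasDerivAt V
      (-((2 * Real.sqrt μ) • V t) - (1 + Δ₁) • gradient f (X t) - Δ₂ • G t) t)
    (E : ℝ → ℝ)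
    (hE : ∀ t, E t = Real.exp (Real.sqrt μ * t) *
      ((1 + Δ₁) * (f (X t) - f xs) +
        (1 / 2) * ‖V t + Real.sqrt μ • (X t - xs) + Δ₂ • gradient f (X t)‖ ^ 2)) :
    ∀ t, 0 ≤ t → DifferentiableAt ℝ E t ∧
      deriv E t * Real.exp (-(Real.sqrt μ * t)) ≤
        -(Real.sqrt μ / 2) * ‖V t‖ ^ 2
        - (μ * Real.sqrt μ / 2) * Δ₁ * ‖X t - xs‖ ^ 2
        + Δ₂ * ((Real.sqrt μ / 2) * Δ₂ - Δ₁) * ‖gradient f (X t)‖ ^ 2 := by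
  intro t _
  have hfd : Differentiable ℝ f := hf.differentiable (by norm_num)
  set s := Real.sqrt μ
  have hs : 0 ≤ s := Real.sqrt_nonneg μ
  have hs2 : s ^ 2 = μ := Real.sq_sqrt hμ.le
  have hF : HasDerivAt (fun τ => f (X τ)) (inner ℝ (gradient f (X t)) (V t)) t := by
    exact (hfd (X t)).hasGradientAt.hasFDerivAt.comp_hasDerivAt t (hX t)
  have hW : HasDerivAt (fun τ => V τ + s • (X τ - xs) + Δ₂ • gradient f (X τ))
      (-(s • V t) - (1 + Δ₁) • gradient f (X t)) t := by
    refine (((hV t).add (((hX t).sub_const xs).const_smul s)).add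
      ((hG t).const_smul Δ₂)).congr_deriv ?_
    module
  have hexp : HasDerivAt (fun τ => Real.exp (s * τ)) (Real.exp (s * t) * s) t := by
    simpa using ((hasDerivAt_id t).const_mul s).exp
  have hE' := hexp.mul (((hF.sub_const (f xs)).const_mul (1 + Δ₁)).add
    (hW.norm_sq.const_mul (1 / 2)))
  replace hE' := hE'.congr_of_eventuallyEq (Filter.Eventually.of_forall hE)
  refine ⟨hE'.differentiableAt, ?_⟩
  rw [hE'.deriv]
  have h1 := hsc.add_inner_gradient_add_le (hfd (X t)) xs
  have h2 := hsc.add_inner_gradient_add_le (hfd xs) (X t)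
  have hgrad : gradient f xs = 0 := by
    have : IsLocalMin f xs := Filter.Eventually.of_forall hmin
    simp [gradient, this.fderiv_eq_zero]
  rw [hgrad, inner_zero_left] at h2
  rw [← neg_sub (X t) xs, inner_neg_right, norm_neg] at h1
  have hexp1 : Real.exp (s * t) * Real.exp (-(s * t)) = 1 := by
    rw [← Real.exp_add, add_neg_cancel, Real.exp_zero]
  simp only [Pi.add_apply]
  generalize X t - xs = d at *
  generalize gradient f (X t) = g at *
  generalize V t = v at *
  have hgd : μ * inner ℝ g d ≤ ‖g‖ ^ 2 := by
    have h3 : 0 ≤ ‖g - μ • d‖ ^ 2 := sq_nonneg _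
    rw [norm_sub_sq_real, norm_smul, inner_smul_right, mul_pow, Real.norm_eq_abs, sq_abs] at h3
    have h4 : μ * (μ * ‖d‖ ^ 2) ≤ μ * inner ℝ g d :=
      mul_le_mul_of_nonneg_left (by linarith) hμ.le
    linarith
  have hnorm : ‖v + s • d + Δ₂ • g‖ ^ 2 = ‖v‖ ^ 2 + s ^ 2 * ‖d‖ ^ 2 + Δ₂ ^ 2 * ‖g‖ ^ 2
      + 2 * s * inner ℝ d v + 2 * Δ₂ * inner ℝ g v + 2 * s * Δ₂ * inner ℝ g d := by
    simp only [← real_inner_self_eq_norm_sq, inner_add_left, inner_add_right,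
      real_inner_smul_left, real_inner_smul_right, real_inner_comm d g, real_inner_comm v d,
      real_inner_comm v g]
    ring
  have hinner : inner ℝ (v + s • d + Δ₂ • g) (-(s • v) - (1 + Δ₁) • g) =
      -s * ‖v‖ ^ 2 - (1 + Δ₁) * inner ℝ g v - s ^ 2 * inner ℝ d v
      - s * (1 + Δ₁) * inner ℝ g d - s * Δ₂ * inner ℝ g v - Δ₂ * (1 + Δ₁) * ‖g‖ ^ 2 := by
    simp only [← real_inner_self_eq_norm_sq, inner_add_left, inner_sub_right, inner_neg_right,
      real_inner_smul_left, real_inner_smul_right]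
    rw [real_inner_comm g v, real_inner_comm g d]
    ring
  rw [hnorm, hinner]
  have h5 := mul_le_mul_of_nonneg_left h1 (mul_nonneg hs (add_nonneg zero_le_one hΔ₁))
  have h6 := mul_le_mul_of_nonneg_left hgd hΔ₂
  rw [← hs2] at h5 h6 ⊢
  have hfactor : ∀ a b : ℝ, (Real.exp (s * t) * s * a + Real.exp (s * t) * b) *
      Real.exp (-(s * t)) = s * a + b := fun a b => by
    linear_combination (s * a + b) * hexp1
  rw [hfactor]
  linarith
end

section
/- Let X be a solution of the perturbed ODE with Δ₁ = 0 and Δ₂ > 0, and assume in addition that f is L-smooth (∇f is L-Lipschitz). Then for all t ≥ 0, f(X_t) − f(x*) ≤ e^{−√μ t(1 − Δ₂²L)}·E(0). -/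
section StrongConvexSmooth

open scoped InnerProductSpace

variable {H : Type*} [NormedAddCommGroup H] [InnerProductSpace ℝ H] {L : ℝ}

lemma hasDerivAt_add_smul_const (x d : H) (τ : ℝ) :
    HasDerivAt (fun τ : ℝ => x + τ • d) d τ := by
  simpa using ((hasDerivAt_id τ).smul_const d).const_add x

/-- The dissipation inequality for the Lyapunov function of the gradient-corrected flow, with
`s = √μ` and `a = f x - f xs`. -/
lemma lyapunov_dissipation_le {s D a : ℝ} (hs : 0 ≤ s) (hD : 0 ≤ D) (hL₀ : 0 ≤ L) {y v g : H}
    (hconv : a + s ^ 2 / 2 * ‖y‖ ^ 2 ≤ ⟪g, y⟫_ℝ) (hg : s ^ 2 * ⟪g, y⟫_ℝ ≤ ‖g‖ ^ 2)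
    (hg' : ‖g‖ ^ 2 ≤ 2 * L * a) :
    s * (a + 1 / 2 * ‖v + s • y + D • g‖ ^ 2) +
        (⟪g, v⟫_ℝ + ⟪v + s • y + D • g, -(s • v) - g⟫_ℝ) ≤
      s * D ^ 2 * L * (a + 1 / 2 * ‖v + s • y + D • g‖ ^ 2) := by
  have hkin : 0 ≤ s * D ^ 2 * L * (1 / 2 * ‖v + s • y + D • g‖ ^ 2) := by positivity
  have hident : s * (a + 1 / 2 * ‖v + s • y + D • g‖ ^ 2) +
        (⟪g, v⟫_ℝ + ⟪v + s • y + D • g, -(s • v) - g⟫_ℝ) =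
      s * (a + s ^ 2 / 2 * ‖y‖ ^ 2 - ⟪g, y⟫_ℝ) + D * (s ^ 2 * ⟪g, y⟫_ℝ - ‖g‖ ^ 2)
        - s / 2 * ‖v‖ ^ 2 + s * D ^ 2 / 2 * ‖g‖ ^ 2 := by
    simp only [← real_inner_self_eq_norm_sq, inner_add_left, inner_add_right, inner_sub_right,
      inner_neg_right, real_inner_smul_left, real_inner_smul_right]
    rw [real_inner_comm g y, real_inner_comm v y, real_inner_comm g v]
    ring
  have h₁ : s * (a + s ^ 2 / 2 * ‖y‖ ^ 2 - ⟪g, y⟫_ℝ) ≤ 0 :=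
    mul_nonpos_of_nonneg_of_nonpos hs (by linarith)
  have h₂ : D * (s ^ 2 * ⟪g, y⟫_ℝ - ‖g‖ ^ 2) ≤ 0 :=
    mul_nonpos_of_nonneg_of_nonpos hD (by linarith)
  have h₃ : s * D ^ 2 / 2 * ‖g‖ ^ 2 ≤ s * D ^ 2 / 2 * (2 * L * a) := by gcongr
  have h₄ : 0 ≤ s / 2 * ‖v‖ ^ 2 := by positivity
  linarith

variable [CompleteSpace H] {f : H → ℝ} {μ : ℝ}

lemma HasGradientAt.comp_hasDerivAt_inner {g v : H} {X : ℝ → H} {t : ℝ}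
    (hf : HasGradientAt f g (X t)) (hX : HasDerivAt X v t) :
    HasDerivAt (fun τ => f (X τ)) ⟪g, v⟫_ℝ t :=
  ((hasGradientAt_iff_hasFDerivAt.1 hf).comp_hasDerivAt t hX).congr_deriv (by simp)

/-- First-order lower bound for strongly convex functions. -/
lemma StrongConvexOn.add_inner_gradient_le (hsc : StrongConvexOn Set.univ μ f)
    (hf : Differentiable ℝ f) (x y : H) :
    f x + ⟪gradient f x, y - x⟫_ℝ + μ / 2 * ‖y - x‖ ^ 2 ≤ f y := by
  have hconv : ConvexOn ℝ Set.univ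
      (fun τ : ℝ => f (x + τ • (y - x)) - μ / 2 * ‖x + τ • (y - x)‖ ^ 2) := by
    have h := (strongConvexOn_iff_convex.1 hsc).comp_affineMap (AffineMap.lineMap x y : ℝ →ᵃ[ℝ] H)
    rw [Set.preimage_univ] at h
    refine h.congr fun τ _ => ?_
    simp [AffineMap.lineMap_apply, add_comm]
  have hline := hasDerivAt_add_smul_const x (y - x) 0
  have hderiv : HasDerivAt
      (fun τ : ℝ => f (x + τ • (y - x)) - μ / 2 * ‖x + τ • (y - x)‖ ^ 2)
      (⟪gradient f x, y - x⟫_ℝ - μ / 2 * (2 * ⟪x, y - x⟫_ℝ)) 0 := by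
    have h₁ := (hf (x + (0 : ℝ) • (y - x))).hasGradientAt.comp_hasDerivAt_inner
      (X := fun τ : ℝ => x + τ • (y - x)) hline
    have h₂ := hline.norm_sq.const_mul (μ / 2)
    exact (h₁.sub h₂).congr_deriv (by simp)
  have h := hconv.le_slope_of_hasDerivAt (Set.mem_univ 0) (Set.mem_univ 1) one_pos hderiv
  simp only [slope_def_field, one_smul, zero_smul, add_zero, sub_zero, div_one,
    add_sub_cancel] at h
  rw [norm_sub_sq_real, real_inner_comm x y]
  rw [inner_sub_right x, real_inner_self_eq_norm_sq] at h
  linarith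

/-- The descent lemma. -/
lemma le_add_inner_gradient_of_gradient_lipschitz (hf : Differentiable ℝ f)
    (hL : ∀ x y, ‖gradient f x - gradient f y‖ ≤ L * ‖x - y‖) (x d : H) :
    f (x + d) ≤ f x + ⟪gradient f x, d⟫_ℝ + L / 2 * ‖d‖ ^ 2 := by
  have hderiv (τ : ℝ) : HasDerivAt
      (fun τ : ℝ => f (x + τ • d) - τ * ⟪gradient f x, d⟫_ℝ - L / 2 * ‖d‖ ^ 2 * τ ^ 2)
      (⟪gradient f (x + τ • d), d⟫_ℝ - ⟪gradient f x, d⟫_ℝ - L * τ * ‖d‖ ^ 2) τ := by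
    have h₁ := (hf (x + τ • d)).hasGradientAt.comp_hasDerivAt_inner
      (X := fun τ : ℝ => x + τ • d) (hasDerivAt_add_smul_const x d τ)
    refine ((h₁.sub ((hasDerivAt_id τ).mul_const _)).sub
      ((hasDerivAt_pow 2 τ).const_mul (L / 2 * ‖d‖ ^ 2))).congr_deriv ?_
    norm_num
    ring
  have hanti := antitoneOn_of_hasDerivWithinAt_nonpos (convex_Ici (0 : ℝ))
    (fun τ _ => (hderiv τ).continuousAt.continuousWithinAt)
    (fun τ _ => (hderiv τ).hasDerivWithinAt) (fun τ hτ => by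
      rw [interior_Ici] at hτ
      have h := hL (x + τ • d) x
      rw [add_sub_cancel_left, norm_smul, Real.norm_of_nonneg hτ.le] at h
      have h' := (real_inner_le_norm (gradient f (x + τ • d) - gradient f x) d).trans
        (mul_le_mul_of_nonneg_right h (norm_nonneg d))
      rw [inner_sub_left] at h'
      linarith)
  have h := hanti Set.self_mem_Ici (Set.mem_Ici.2 zero_le_one) zero_le_one
  simp only [one_smul, zero_smul, add_zero] at h
  linarith

lemma norm_gradient_sq_le_of_forall_le (hf : Differentiable ℝ f) (hL₀ : 0 < L)
    (hL : ∀ x y, ‖gradient f x - gradient f y‖ ≤ L * ‖x - y‖) {xs : H}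
    (hmin : ∀ y, f xs ≤ f y) (x : H) :
    ‖gradient f x‖ ^ 2 ≤ 2 * L * (f x - f xs) := by
  have h := (hmin _).trans
    (le_add_inner_gradient_of_gradient_lipschitz hf hL x (-(L⁻¹ • gradient f x)))
  rw [norm_neg, norm_smul, inner_neg_right, real_inner_smul_right, real_inner_self_eq_norm_sq,
    mul_pow, Real.norm_of_nonneg (inv_pos.2 hL₀).le] at h
  have h' : L / 2 * (L⁻¹ ^ 2 * ‖gradient f x‖ ^ 2) = L⁻¹ * ‖gradient f x‖ ^ 2 / 2 := by
    field_simp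
  have hcancel : L * (L⁻¹ * ‖gradient f x‖ ^ 2) = ‖gradient f x‖ ^ 2 := by field_simp
  nlinarith

lemma gradient_eq_zero_of_forall_le {xs : H} (hmin : ∀ y, f xs ≤ f y) : gradient f xs = 0 := by
  have h : IsLocalMin f xs := Filter.Eventually.of_forall hmin
  simp [gradient, h.fderiv_eq_zero]

/-- A strongly convex function has a strongly monotone gradient at its minimizer. -/
lemma StrongConvexOn.mul_norm_sq_le_inner_gradient (hsc : StrongConvexOn Set.univ μ f)
    (hf : Differentiable ℝ f) {xs : H} (hmin : ∀ y, f xs ≤ f y) (x : H) :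
    μ * ‖x - xs‖ ^ 2 ≤ ⟪gradient f x, x - xs⟫_ℝ := by
  have h₁ := hsc.add_inner_gradient_le hf x xs
  have h₂ := hsc.add_inner_gradient_le hf xs x
  rw [gradient_eq_zero_of_forall_le hmin, inner_zero_left] at h₂
  rw [← neg_sub x xs, inner_neg_right, norm_neg] at h₁
  linarith

lemma StrongConvexOn.mul_inner_gradient_le_norm_sq (hsc : StrongConvexOn Set.univ μ f)
    (hμ : 0 < μ) (hf : Differentiable ℝ f) {xs : H} (hmin : ∀ y, f xs ≤ f y) (x : H) :
    μ * ⟪gradient f x, x - xs⟫_ℝ ≤ ‖gradient f x‖ ^ 2 := by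
  have h₁ := hsc.mul_norm_sq_le_inner_gradient hf hmin x
  have h₂ : ‖gradient f x - μ • (x - xs)‖ ^ 2 =
      ‖gradient f x‖ ^ 2 - 2 * (μ * ⟪gradient f x, x - xs⟫_ℝ) + μ ^ 2 * ‖x - xs‖ ^ 2 := by
    rw [norm_sub_sq_real, real_inner_smul_right, norm_smul, mul_pow, Real.norm_of_nonneg hμ.le]
  nlinarith [sq_nonneg ‖gradient f x - μ • (x - xs)‖, mul_le_mul_of_nonneg_left h₁ hμ.le]

lemma StrongConvexOn.lipschitz_const_pos [Nontrivial H] (hsc : StrongConvexOn Set.univ μ f)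
    (hμ : 0 < μ) (hf : Differentiable ℝ f)
    (hL : ∀ x y, ‖gradient f x - gradient f y‖ ≤ L * ‖x - y‖) {xs : H}
    (hmin : ∀ y, f xs ≤ f y) : 0 < L := by
  obtain ⟨x, hx⟩ := exists_ne xs
  have hpos : 0 < ‖x - xs‖ := norm_pos_iff.2 (sub_ne_zero.2 hx)
  have h₁ := hsc.mul_norm_sq_le_inner_gradient hf hmin x
  have h₂ := real_inner_le_norm (gradient f x) (x - xs)
  have h₃ := hL x xs
  rw [gradient_eq_zero_of_forall_le hmin, sub_zero] at h₃
  have h₄ : 0 < ‖gradient f x‖ * ‖x - xs‖ := by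
    have : 0 < μ * ‖x - xs‖ ^ 2 := by positivity
    linarith
  exact pos_of_mul_pos_left ((pos_of_mul_pos_left h₄ hpos.le).trans_le h₃) hpos.le

end StrongConvexSmooth

/-- with `Δ₁ = 0`, `Δ₂ > 0` and `f` `L`-smooth, the function values along the
perturbed ODE satisfy `f(X_t) − f(x*) ≤ e^{−√μ t (1 − Δ₂² L)} E(0)`. -/
theorem perturbed_ode_rate_gradient_correction_only
    {H : Type*} [NormedAddCommGroup H] [InnerProductSpace ℝ H] [FiniteDimensional ℝ H]
    (f : H → ℝ) (μ L : ℝ) (hμ : 0 < μ)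
    (hf : ContDiff ℝ 2 f) (hsc : StrongConvexOn Set.univ μ f)
    (hL : ∀ x y, ‖gradient f x - gradient f y‖ ≤ L * ‖x - y‖)
    (xs : H) (hmin : ∀ y, f xs ≤ f y)
    (Δ₁ Δ₂ : ℝ) (hΔ₁ : Δ₁ = 0) (hΔ₂ : 0 < Δ₂)
    (X V G : ℝ → H)
    (hX : ∀ t, HasDerivAt X (V t) t)
    (hG : ∀ t, HasDerivAt (fun τ => gradient f (X τ)) (G t) t)
    (hV : ∀ t, HasDerivAt V
      (-((2 * Real.sqrt μ) • V t) - (1 + Δ₁) • gradient f (X t) - Δ₂ • G t) t)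
    (E : ℝ → ℝ)
    (hE : ∀ t, E t = Real.exp (Real.sqrt μ * t) *
      ((1 + Δ₁) * (f (X t) - f xs) +
        (1 / 2) * ‖V t + Real.sqrt μ • (X t - xs) + Δ₂ • gradient f (X t)‖ ^ 2)) :
    ∀ t, 0 ≤ t →
      f (X t) - f xs ≤ Real.exp (-(Real.sqrt μ * t * (1 - Δ₂ ^ 2 * L))) * E 0 := by
  have hdiff : Differentiable ℝ f := hf.differentiable (by norm_num)
  intro t ht
  rcases subsingleton_or_nontrivial H with hH | hH
  · have hXt (τ : ℝ) : X τ = xs := Subsingleton.elim _ _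
    have hW (τ : ℝ) : V τ + Real.sqrt μ • (X τ - xs) + Δ₂ • gradient f (X τ) = 0 :=
      Subsingleton.elim _ _
    simp only [hE, hW]
    simp [hXt]
  have hL₀ : 0 < L := hsc.lipschitz_const_pos hμ hdiff hL hmin
  set s := Real.sqrt μ with hs
  have hs₂ : s ^ 2 = μ := Real.sq_sqrt hμ.le
  have hs₀ : 0 ≤ s := Real.sqrt_nonneg μ
  subst hΔ₁
  simp only [add_zero, one_mul, one_smul] at hE hV
  set W : ℝ → H := fun τ => V τ + s • (X τ - xs) + Δ₂ • gradient f (X τ) with hWdef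
  set F : ℝ → ℝ := fun τ => f (X τ) - f xs + 1 / 2 * ‖W τ‖ ^ 2 with hFdef
  have hW (τ : ℝ) : HasDerivAt W (-(s • V τ) - gradient f (X τ)) τ := by
    refine (((hV τ).add (((hX τ).sub_const xs).const_smul s)).add
      ((hG τ).const_smul Δ₂)).congr_deriv ?_
    module
  have hF (τ : ℝ) : HasDerivAt F
      (inner ℝ (gradient f (X τ)) (V τ) + inner ℝ (W τ) (-(s • V τ) - gradient f (X τ))) τ := by
    refine ((((hdiff (X τ)).hasGradientAt.comp_hasDerivAt_inner (hX τ)).sub_const (f xs)).add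
      ((hW τ).norm_sq.const_mul (1 / 2))).congr_deriv ?_
    ring
  have hdiss (τ : ℝ) : s * F τ + (inner ℝ (gradient f (X τ)) (V τ) +
      inner ℝ (W τ) (-(s • V τ) - gradient f (X τ))) ≤ s * Δ₂ ^ 2 * L * F τ := by
    refine lyapunov_dissipation_le hs₀ hΔ₂.le hL₀.le ?_ ?_
      (norm_gradient_sq_le_of_forall_le hdiff hL₀ hL hmin (X τ))
    · have h := hsc.add_inner_gradient_le hdiff (X τ) xs
      rw [← neg_sub (X τ) xs, inner_neg_right, norm_neg] at h
      rw [hs₂]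
      linarith
    · rw [hs₂]
      exact hsc.mul_inner_gradient_le_norm_sq hμ hdiff hmin (X τ)
  set c := s * (1 - Δ₂ ^ 2 * L) with hc
  have hΦ (τ : ℝ) : HasDerivAt (fun τ => Real.exp (c * τ) * F τ)
      (Real.exp (c * τ) * (c * F τ + (inner ℝ (gradient f (X τ)) (V τ) +
        inner ℝ (W τ) (-(s • V τ) - gradient f (X τ))))) τ := by
    refine ((((hasDerivAt_id τ).const_mul c).exp).mul (hF τ)).congr_deriv ?_
    simp only [id_eq]
    ring
  have hanti := antitone_of_hasDerivAt_nonpos hΦ fun τ =>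
    mul_nonpos_of_nonneg_of_nonpos (Real.exp_pos _).le (by linear_combination hdiss τ)
  have hE₀ : E 0 = F 0 := by simp [hE, hFdef, hWdef]
  have h : Real.exp (c * t) * F t ≤ E 0 := by simpa [hE₀] using hanti ht
  have hexp : Real.exp (-(s * t * (1 - Δ₂ ^ 2 * L))) * Real.exp (c * t) = 1 := by
    rw [← Real.exp_add, Real.exp_eq_one_iff]
    ring
  calc f (X t) - f xs ≤ F t := le_add_of_nonneg_right (by positivity)
    _ = Real.exp (-(s * t * (1 - Δ₂ ^ 2 * L))) * (Real.exp (c * t) * F t) := by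
      rw [← mul_assoc, hexp, one_mul]
    _ ≤ _ := by gcongr
end

section
/- Let X be a solution of the perturbed ODE. If 0 < (√μ/2)Δ₂ < Δ₁, then with c₁ = min{ 2μΔ₂(Δ₁ − (√μ/2)Δ₂)/(1 + Δ₁ + 3μΔ₂²), √μ/3, (√μ/3)Δ₁ } > 0, the Lyapunov function satisfies E'(t) ≤ −c₁·E(t) for all t ≥ 0, and consequently f(X_t) − f(x*) ≤ (1/(1+Δ₁))·e^{−(√μ + c₁)t}·E(0) for all t ≥ 0. -/
section StrongConvexity

variable {H : Type*} [NormedAddCommGroup H] [InnerProductSpace ℝ H] [CompleteSpace H]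

/-- A differentiable strongly convex function lies above its quadratic minorants. -/
lemma StrongConvexOn.add_inner_gradient_add_sq_le {f : H → ℝ} {μ : ℝ}
    (hsc : StrongConvexOn Set.univ μ f) {x : H} (hf : DifferentiableAt ℝ f x) (y : H) :
    f x + inner ℝ (gradient f x) (y - x) + μ / 2 * ‖y - x‖ ^ 2 ≤ f y := by
  have hline : HasDerivAt (fun t : ℝ => AffineMap.lineMap x y t) (y - x) 0 :=
    AffineMap.hasDerivAt_lineMap
  have hgrad : HasFDerivAt f (InnerProductSpace.toDual ℝ H (gradient f x))
      (AffineMap.lineMap x y (0 : ℝ)) := by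
    simpa using hf.hasGradientAt.hasFDerivAt
  have hnorm := hline.norm_sq
  have hder := (hgrad.comp_hasDerivAt (0 : ℝ) hline).sub (hnorm.const_mul (μ / 2))
  have hconv := (strongConvexOn_iff_convex.1 hsc).comp_affineMap (AffineMap.lineMap x y : ℝ →ᵃ[ℝ] H)
  have hslope := hconv.le_slope_of_hasDerivAt (x := 0) (y := 1) (by simp) (by simp) one_pos hder
  simp only [slope_def_field, Function.comp_apply, AffineMap.lineMap_apply_one,
    AffineMap.lineMap_apply_zero, InnerProductSpace.toDual_apply_apply, sub_zero, div_one]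
    at hslope
  have hexp : ‖y - x‖ ^ 2 = ‖y‖ ^ 2 - ‖x‖ ^ 2 - 2 * inner ℝ x (y - x) := by
    rw [norm_sub_sq_real, inner_sub_right, real_inner_self_eq_norm_sq, real_inner_comm]
    ring
  rw [hexp]
  linarith

end StrongConvexity

/-- A differential inequality `E' ≤ -c E` on `[0, ∞)` forces exponential decay. -/
lemma le_exp_neg_mul_of_hasDerivAt_le {E E' : ℝ → ℝ} {c : ℝ}
    (hE : ∀ t, HasDerivAt E (E' t) t) (hle : ∀ t, 0 ≤ t → E' t ≤ -c * E t)
    {t : ℝ} (ht : 0 ≤ t) : E t ≤ Real.exp (-(c * t)) * E 0 := by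
  have hder : ∀ u, HasDerivAt (fun u => Real.exp (c * u) * E u)
      (Real.exp (c * u) * (c * 1) * E u + Real.exp (c * u) * E' u) u := fun u =>
    (((hasDerivAt_id u).const_mul c).exp).mul (hE u)
  have hanti : AntitoneOn (fun u => Real.exp (c * u) * E u) (Set.Ici 0) := by
    refine antitoneOn_of_deriv_nonpos (convex_Ici 0)
      (fun u _ => (hder u).continuousAt.continuousWithinAt)
      (fun u _ => (hder u).differentiableAt.differentiableWithinAt) fun u hu => ?_
    rw [(hder u).deriv]
    rw [interior_Ici] at hu
    nlinarith [hle u (le_of_lt hu), Real.exp_pos (c * u)]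
  have h := hanti Set.self_mem_Ici ht ht
  simp only [mul_zero, Real.exp_zero, one_mul] at h
  rw [Real.exp_neg, inv_mul_eq_div, le_div_iff₀ (Real.exp_pos _)]
  linarith

/-- The pointwise estimate behind the decay of the Lyapunov function: `v`, `d`, `g` are the
velocity, the displacement from the minimizer and the gradient, `F` the optimality gap. -/
lemma lyapunov_dissipation_le_s3 {H : Type*} [NormedAddCommGroup H] [InnerProductSpace ℝ H]
    {s a D c F : ℝ} {v d g : H} (hs : 0 < s) (ha : 0 ≤ a) (hD : 0 ≤ D) (hc : 0 ≤ c)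
    (hF : s ^ 2 / 2 * ‖d‖ ^ 2 ≤ F) (hgd : F + s ^ 2 / 2 * ‖d‖ ^ 2 ≤ inner ℝ g d)
    (hc₁ : c * (1 + a + 3 * s ^ 2 * D ^ 2) ≤ 2 * s ^ 2 * D * (a - s / 2 * D))
    (hc₂ : c ≤ s / 3) (hc₃ : c ≤ s / 3 * a) :
    s * ((1 + a) * F + 1 / 2 * ‖v + s • d + D • g‖ ^ 2) + ((1 + a) * inner ℝ g v
        + inner ℝ (v + s • d + D • g) (-(s • v) - (1 + a) • g))
      ≤ -c * ((1 + a) * F + 1 / 2 * ‖v + s • d + D • g‖ ^ 2) := by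
  have hs2 : 0 < s ^ 2 := by positivity
  have hsq : 0 ≤ ‖g‖ ^ 2 - 2 * s ^ 2 * inner ℝ g d + s ^ 4 * ‖d‖ ^ 2 := by
    have h := sq_nonneg ‖g - s ^ 2 • d‖
    rw [norm_sub_sq_real, inner_smul_right, norm_smul, mul_pow, Real.norm_eq_abs, sq_abs] at h
    linarith
  have hPL : 2 * s ^ 2 * F ≤ ‖g‖ ^ 2 := by nlinarith
  have hcross : s ^ 2 * inner ℝ g d ≤ ‖g‖ ^ 2 := by nlinarith
  have hW : ‖v + s • d + D • g‖ ^ 2 = ‖v‖ ^ 2 + s ^ 2 * ‖d‖ ^ 2 + D ^ 2 * ‖g‖ ^ 2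
      + 2 * s * inner ℝ v d + 2 * D * inner ℝ g v + 2 * s * D * inner ℝ g d := by
    simp only [← real_inner_self_eq_norm_sq, inner_add_left, inner_add_right,
      real_inner_smul_left, real_inner_smul_right]
    rw [real_inner_comm v d, real_inner_comm g v, real_inner_comm g d]
    ring
  have hW3 : ‖v + s • d + D • g‖ ^ 2 ≤ 3 * (‖v‖ ^ 2 + s ^ 2 * ‖d‖ ^ 2 + D ^ 2 * ‖g‖ ^ 2) := by
    have h₁ := sq_nonneg ‖v - s • d‖
    have h₂ := sq_nonneg ‖v - D • g‖
    have h₃ := sq_nonneg ‖s • d - D • g‖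
    rw [norm_sub_sq_real] at h₁ h₂ h₃
    simp only [real_inner_smul_left, real_inner_smul_right, norm_smul, mul_pow,
      Real.norm_eq_abs, sq_abs] at h₁ h₂ h₃
    rw [real_inner_comm] at h₂ h₃
    rw [hW]
    linarith
  have hI : inner ℝ (v + s • d + D • g) (-(s • v) - (1 + a) • g)
      = -s * ‖v‖ ^ 2 - s ^ 2 * inner ℝ v d - s * D * inner ℝ g v - (1 + a) * inner ℝ g v
        - (1 + a) * s * inner ℝ g d - (1 + a) * D * ‖g‖ ^ 2 := by
    simp only [← real_inner_self_eq_norm_sq, inner_add_left, inner_sub_right, inner_neg_right,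
      real_inner_smul_left, real_inner_smul_right]
    rw [real_inner_comm v d, real_inner_comm g v, real_inner_comm g d]
    ring
  have hdecay : s * ((1 + a) * F + 1 / 2 * ‖v + s • d + D • g‖ ^ 2) + ((1 + a) * inner ℝ g v
        + inner ℝ (v + s • d + D • g) (-(s • v) - (1 + a) • g))
      ≤ -(D * (a - s / 2 * D) * ‖g‖ ^ 2) - a * s ^ 3 / 2 * ‖d‖ ^ 2 - s / 2 * ‖v‖ ^ 2 := by
    rw [hI, hW]
    have h₁ := mul_le_mul_of_nonneg_left hgd (by positivity : 0 ≤ s * (1 + a))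
    have h₂ := mul_le_mul_of_nonneg_left hcross hD
    linarith
  have hg : c * ((1 + a) * F + 3 / 2 * D ^ 2 * ‖g‖ ^ 2) ≤ D * (a - s / 2 * D) * ‖g‖ ^ 2 := by
    have h₁ := mul_le_mul_of_nonneg_left hPL (by positivity : 0 ≤ c * (1 + a))
    have h₂ := mul_le_mul_of_nonneg_right hc₁ (sq_nonneg ‖g‖)
    refine le_of_mul_le_mul_left ?_ (by positivity : 0 < 2 * s ^ 2)
    linarith
  have hv := mul_le_mul_of_nonneg_right hc₂ (sq_nonneg ‖v‖)
  have hd := mul_le_mul_of_nonneg_right hc₃ (by positivity : 0 ≤ s ^ 2 * ‖d‖ ^ 2)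
  have hcW := mul_le_mul_of_nonneg_left hW3 hc
  linarith

/-- faster convergence rate for the perturbed ODE when `0 < (√μ/2)Δ₂ < Δ₁`. -/
theorem perturbed_ode_faster_rate
    {H : Type*} [NormedAddCommGroup H] [InnerProductSpace ℝ H] [FiniteDimensional ℝ H]
    (f : H → ℝ) (μ : ℝ) (hμ : 0 < μ)
    (hf : ContDiff ℝ 2 f) (hsc : StrongConvexOn Set.univ μ f)
    (xs : H) (hmin : ∀ y, f xs ≤ f y)
    (Δ₁ Δ₂ : ℝ) (hΔ₁ : 0 ≤ Δ₁) (hΔ₂ : 0 ≤ Δ₂)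
    (hcond₁ : 0 < Real.sqrt μ / 2 * Δ₂) (hcond₂ : Real.sqrt μ / 2 * Δ₂ < Δ₁)
    (X V G : ℝ → H)
    (hX : ∀ t, HasDerivAt X (V t) t)
    (hG : ∀ t, HasDerivAt (fun τ => gradient f (X τ)) (G t) t)
    (hV : ∀ t, HasDerivAt V
      (-((2 * Real.sqrt μ) • V t) - (1 + Δ₁) • gradient f (X t) - Δ₂ • G t) t)
    (E : ℝ → ℝ)
    (hE : ∀ t, E t = Real.exp (Real.sqrt μ * t) *
      ((1 + Δ₁) * (f (X t) - f xs) +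
        (1 / 2) * ‖V t + Real.sqrt μ • (X t - xs) + Δ₂ • gradient f (X t)‖ ^ 2))
    (c₁ : ℝ)
    (hc₁ : c₁ = min (2 * μ * Δ₂ / (1 + Δ₁ + 3 * μ * Δ₂ ^ 2) * (Δ₁ - Real.sqrt μ / 2 * Δ₂))
      (min (Real.sqrt μ / 3) (Real.sqrt μ / 3 * Δ₁))) :
    0 < c₁ ∧
    (∀ t, 0 ≤ t → deriv E t ≤ -c₁ * E t) ∧
    (∀ t, 0 ≤ t →
      f (X t) - f xs ≤ 1 / (1 + Δ₁) * Real.exp (-((Real.sqrt μ + c₁) * t)) * E 0) := by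
  set s := Real.sqrt μ with hs_def
  have hs : 0 < s := Real.sqrt_pos.2 hμ
  have hsμ : s ^ 2 = μ := Real.sq_sqrt hμ.le
  have hΔ₂pos : 0 < Δ₂ := pos_of_mul_pos_right hcond₁ (by positivity)
  have hΔ₁pos : 0 < Δ₁ := hcond₁.trans hcond₂
  have hgap : 0 < Δ₁ - s / 2 * Δ₂ := sub_pos.2 hcond₂
  have hden : 0 < 1 + Δ₁ + 3 * μ * Δ₂ ^ 2 := by positivity
  have hc_pos : 0 < c₁ := by
    rw [hc₁]
    exact lt_min (by positivity) (lt_min (by positivity) (by positivity))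
  have hc_grad : c₁ * (1 + Δ₁ + 3 * s ^ 2 * Δ₂ ^ 2) ≤ 2 * s ^ 2 * Δ₂ * (Δ₁ - s / 2 * Δ₂) := by
    rw [hsμ, ← le_div_iff₀ hden, mul_div_right_comm]
    exact hc₁.trans_le (min_le_left _ _)
  have hc_vel : c₁ ≤ s / 3 := hc₁.trans_le ((min_le_right _ _).trans (min_le_left _ _))
  have hc_disp : c₁ ≤ s / 3 * Δ₁ := hc₁.trans_le ((min_le_right _ _).trans (min_le_right _ _))
  have hdiff : Differentiable ℝ f := hf.differentiable (by norm_num)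
  have hcrit : gradient f xs = 0 := by
    have h : IsLocalMin f xs := Filter.Eventually.of_forall hmin
    simp [gradient, h.fderiv_eq_zero]
  have hgrowth (x : H) : s ^ 2 / 2 * ‖x - xs‖ ^ 2 ≤ f x - f xs := by
    have h := hsc.add_inner_gradient_add_sq_le (hdiff xs) x
    rw [hcrit, inner_zero_left] at h
    rw [hsμ]
    linarith
  have hinner (x : H) :
      f x - f xs + s ^ 2 / 2 * ‖x - xs‖ ^ 2 ≤ inner ℝ (gradient f x) (x - xs) := by
    have h := hsc.add_inner_gradient_add_sq_le (hdiff x) xs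
    rw [← neg_sub x xs, inner_neg_right, norm_neg] at h
    rw [hsμ]
    linarith
  have hW (t : ℝ) : HasDerivAt (fun τ => V τ + s • (X τ - xs) + Δ₂ • gradient f (X τ))
      (-(s • V t) - (1 + Δ₁) • gradient f (X t)) t := by
    refine (((hV t).add (((hX t).sub_const xs).const_smul s)).add
      ((hG t).const_smul Δ₂)).congr_deriv ?_
    module
  have hfX (t : ℝ) : HasDerivAt (fun τ => f (X τ)) (inner ℝ (gradient f (X t)) (V t)) t := by
    rw [← InnerProductSpace.toDual_apply_apply]
    exact (hdiff (X t)).hasGradientAt.hasFDerivAt.comp_hasDerivAt t (hX t)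
  have hderiv (t : ℝ) : HasDerivAt E (Real.exp (s * t) *
      (s * ((1 + Δ₁) * (f (X t) - f xs)
          + 1 / 2 * ‖V t + s • (X t - xs) + Δ₂ • gradient f (X t)‖ ^ 2)
        + ((1 + Δ₁) * inner ℝ (gradient f (X t)) (V t)
          + inner ℝ (V t + s • (X t - xs) + Δ₂ • gradient f (X t))
            (-(s • V t) - (1 + Δ₁) • gradient f (X t))))) t := by
    rw [funext hE]
    refine ((((hasDerivAt_id t).const_mul s).exp).mul
      ((((hfX t).sub_const (f xs)).const_mul (1 + Δ₁)).add
        ((hW t).norm_sq.const_mul (1 / 2)))).congr_deriv ?_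
    simp only [id, Pi.add_apply]
    ring
  have hle (t : ℝ) := mul_le_mul_of_nonneg_left
    (lyapunov_dissipation_le_s3 (v := V t) hs hΔ₁ hΔ₂ hc_pos.le (hgrowth (X t)) (hinner (X t))
      hc_grad hc_vel hc_disp) (Real.exp_pos (s * t)).le
  simp only [mul_left_comm _ (-c₁), ← hE] at hle
  refine ⟨hc_pos, fun t _ => (hderiv t).deriv.trans_le (hle t), fun t ht => ?_⟩
  have hdecay := le_exp_neg_mul_of_hasDerivAt_le hderiv (fun t _ => hle t) ht
  have hlower : Real.exp (s * t) * ((1 + Δ₁) * (f (X t) - f xs)) ≤ E t := by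
    rw [hE t]
    gcongr
    exact le_add_of_nonneg_right (by positivity)
  have hexp : Real.exp (-((s + c₁) * t)) = Real.exp (-(c₁ * t)) / Real.exp (s * t) := by
    rw [← Real.exp_sub]
    congr 1
    ring
  rw [hexp, show 1 / (1 + Δ₁) * (Real.exp (-(c₁ * t)) / Real.exp (s * t)) * E 0
      = Real.exp (-(c₁ * t)) * E 0 / (Real.exp (s * t) * (1 + Δ₁)) by field_simp,
    le_div_iff₀ (by positivity)]
  linarith
end

section
/- Let (x_k), (v_k) be generated by the implicit Euler scheme. If the perturbation parameters satisfy 0 ≤ (√μ/2)Δ₂ ≤ Δ₁, then for any step size s > 0 and any initial points x₀, v₀, it holds for all k ≥ 0 that f(x_k) − f(x*) ≤ (1/(1+Δ₁))·(1+√(μs))^{−k}·E(0). -/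
open Filter Topology in
/-- First-order characterization of strong convexity at a point with a gradient. -/
theorem StrongConvexOn.add_inner_add_le_of_hasGradientAt
    {H : Type*} [NormedAddCommGroup H] [InnerProductSpace ℝ H] [CompleteSpace H]
    {f : H → ℝ} {μ : ℝ} (hsc : StrongConvexOn Set.univ μ f) {x g : H}
    (hg : HasGradientAt f g x) (y : H) :
    f x + inner ℝ g (y - x) + μ / 2 * ‖y - x‖ ^ 2 ≤ f y := by
  have hd : HasDerivAt (fun t : ℝ => f (x + t • (y - x))) (inner ℝ g (y - x)) 0 := by
    have h1 : HasDerivAt (fun t : ℝ => x + t • (y - x)) (y - x) 0 := by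
      simpa using ((hasDerivAt_id (0 : ℝ)).smul_const (y - x)).const_add x
    have h2 : HasFDerivAt f (InnerProductSpace.toDual ℝ H g) (x + (0 : ℝ) • (y - x)) := by
      simpa using hg.hasFDerivAt
    exact h2.comp_hasDerivAt (0 : ℝ) h1
  have hslope : Tendsto (slope (fun t : ℝ => f (x + t • (y - x))) 0) (𝓝[>] 0)
      (𝓝 (inner ℝ g (y - x))) :=
    (hasDerivAt_iff_tendsto_slope.1 hd).mono_left
      (nhdsWithin_mono _ fun t ht => ne_of_gt ht)
  have hbound : Tendsto (fun t : ℝ => f y - f x - (1 - t) * (μ / 2 * ‖y - x‖ ^ 2)) (𝓝[>] 0)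
      (𝓝 (f y - f x - (1 - 0) * (μ / 2 * ‖y - x‖ ^ 2))) :=
    (Continuous.tendsto (by fun_prop) 0).mono_left nhdsWithin_le_nhds
  have hle := le_of_tendsto_of_tendsto hslope hbound <| by
    filter_upwards [Ioo_mem_nhdsGT (zero_lt_one : (0 : ℝ) < 1)] with t ht
    have h := hsc.2 (Set.mem_univ x) (Set.mem_univ y) (sub_nonneg.2 ht.2.le) ht.1.le
      (sub_add_cancel 1 t)
    have hpt : (1 - t) • x + t • y = x + t • (y - x) := by module
    rw [hpt, norm_sub_rev x y] at h
    simp only [smul_eq_mul] at h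
    rw [slope_def_field, sub_zero, div_le_iff₀ ht.1, zero_smul, add_zero]
    linarith
  linarith

/-- One-step contraction behind the implicit Euler scheme; `d`, `v`, `g` stand for the shifted
position, the velocity and the gradient after the step, `W` for the mixed term before it. -/
theorem one_add_mul_energy_le_of_implicit_euler_step
    {H : Type*} [NormedAddCommGroup H] [InnerProductSpace ℝ H]
    {m h a b F F' : ℝ} {d v g W : H} (hm : 0 < m) (hh : 0 < h) (ha : 0 ≤ a) (hb : 0 ≤ b)
    (hab : m / 2 * b ≤ a)
    (hW : W = v + m • d + b • g + h • (m • v + (1 + a) • g))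
    (hstep : F' ≤ F + h * inner ℝ g v)
    (hd : F' + m ^ 2 / 2 * ‖d‖ ^ 2 ≤ inner ℝ g d) :
    (1 + m * h) * ((1 + a) * F' + 1 / 2 * ‖v + m • d + b • g‖ ^ 2) ≤
      (1 + a) * F + 1 / 2 * ‖W‖ ^ 2 := by
  have hsq : ‖v + m • d + b • g‖ ^ 2 + 2 * (h * inner ℝ (v + m • d + b • g) (m • v + (1 + a) • g))
      ≤ ‖W‖ ^ 2 := by
    rw [hW, norm_add_sq_real (v + m • d + b • g), inner_smul_right]
    linarith [sq_nonneg ‖h • (m • v + (1 + a) • g)‖]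
  have hexp : ‖v + m • d + b • g‖ ^ 2 = ‖v‖ ^ 2 + m ^ 2 * ‖d‖ ^ 2 + b ^ 2 * ‖g‖ ^ 2
      + 2 * m * inner ℝ v d + 2 * b * inner ℝ g v + 2 * m * b * inner ℝ g d := by
    simp only [← real_inner_self_eq_norm_sq, inner_add_left, inner_add_right,
      real_inner_smul_left, real_inner_smul_right, real_inner_comm v d, real_inner_comm g v,
      real_inner_comm g d]
    ring
  have hinner : inner ℝ (v + m • d + b • g) (m • v + (1 + a) • g) =
      m * ‖v‖ ^ 2 + m ^ 2 * inner ℝ v d + m * b * inner ℝ g v + (1 + a) * inner ℝ g v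
        + (1 + a) * m * inner ℝ g d + (1 + a) * b * ‖g‖ ^ 2 := by
    simp only [← real_inner_self_eq_norm_sq, inner_add_left, inner_add_right,
      real_inner_smul_left, real_inner_smul_right, real_inner_comm v d, real_inner_comm g v,
      real_inner_comm g d]
    ring
  have hcross : 0 ≤ m ^ 4 / 4 * ‖d‖ ^ 2 - m ^ 2 * inner ℝ g d + ‖g‖ ^ 2 := by
    have := sq_nonneg ‖g - (m ^ 2 / 2) • d‖
    rw [norm_sub_sq_real, inner_smul_right, norm_smul, mul_pow, Real.norm_eq_abs, sq_abs] at this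
    linarith
  have hkey : 0 ≤ m / 2 * ‖v‖ ^ 2 + (1 + a) * m * (inner ℝ g d - F') - m ^ 3 / 2 * ‖d‖ ^ 2
      + ((1 + a) * b - m * b ^ 2 / 2) * ‖g‖ ^ 2 - m ^ 2 * b * inner ℝ g d := by
    have h1 : 0 ≤ (1 + a) * m * (inner ℝ g d - F' - m ^ 2 / 2 * ‖d‖ ^ 2) :=
      mul_nonneg (by positivity) (by linarith)
    have h2 := mul_nonneg hb hcross
    have h3 : 0 ≤ (a - m / 2 * b) * (m ^ 3 / 2 * ‖d‖ ^ 2 + b * ‖g‖ ^ 2) :=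
      mul_nonneg (sub_nonneg.2 hab) (by positivity)
    have h4 : 0 ≤ m / 2 * ‖v‖ ^ 2 := by positivity
    linarith
  have h5 := mul_nonneg hh.le hkey
  have h6 := mul_le_mul_of_nonneg_left hstep (by linarith : 0 ≤ 1 + a)
  rw [hinner] at hsq
  rw [hexp] at hsq ⊢
  linarith


/-- convergence rate of function values for the implicit Euler scheme
under `0 ≤ (√μ/2)Δ₂ ≤ Δ₁`. -/
theorem implicit_euler_function_value_rate
    {H : Type*} [NormedAddCommGroup H] [InnerProductSpace ℝ H] [CompleteSpace H]
    (f : H → ℝ) (μ : ℝ) (hμ : 0 < μ)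
    (hf : ContDiff ℝ 1 f) (hsc : StrongConvexOn Set.univ μ f)
    (xs : H) (hmin : ∀ y, f xs ≤ f y)
    (s : ℝ) (hs : 0 < s)
    (Δ₁ Δ₂ : ℝ) (hΔ₁ : 0 ≤ Δ₁) (hΔ₂ : 0 ≤ Δ₂)
    (hcond : Real.sqrt μ / 2 * Δ₂ ≤ Δ₁)
    (x v : ℕ → H)
    (hx : ∀ k, (Real.sqrt s)⁻¹ • (x (k + 1) - x k) = v (k + 1))
    (hv : ∀ k, (Real.sqrt s)⁻¹ • (v (k + 1) - v k) =
      -((2 * Real.sqrt μ) • v (k + 1)) - (1 + Δ₁) • gradient f (x (k + 1))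
        - (Δ₂ / Real.sqrt s) • (gradient f (x (k + 1)) - gradient f (x k)))
    (E : ℕ → ℝ)
    (hE : ∀ k, E k = (1 + Real.sqrt (μ * s)) ^ k *
      ((1 + Δ₁) * (f (x k) - f xs) +
        (1 / 2) * ‖v k + Real.sqrt μ • (x k - xs) + Δ₂ • gradient f (x k)‖ ^ 2)) :
    ∀ k, f (x k) - f xs ≤ 1 / (1 + Δ₁) * ((1 + Real.sqrt (μ * s)) ^ k)⁻¹ * E 0 := by
  have hgrad : ∀ y, HasGradientAt f (gradient f y) y := fun y =>
    ((hf.differentiable one_ne_zero) y).hasGradientAt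
  have hm : 0 < Real.sqrt μ := Real.sqrt_pos.2 hμ
  have hh : 0 < Real.sqrt s := Real.sqrt_pos.2 hs
  have hmsq : Real.sqrt μ ^ 2 = μ := Real.sq_sqrt hμ.le
  have hsqrt : Real.sqrt (μ * s) = Real.sqrt μ * Real.sqrt s := Real.sqrt_mul hμ.le s
  have hanti : Antitone E := antitone_nat_of_succ_le fun k => by
    have hxk : x (k + 1) - x k = Real.sqrt s • v (k + 1) := by
      rw [← hx k, smul_inv_smul₀ hh.ne']
    have hvk : v k = v (k + 1) + Real.sqrt s • ((2 * Real.sqrt μ) • v (k + 1)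
        + (1 + Δ₁) • gradient f (x (k + 1)))
        + Δ₂ • (gradient f (x (k + 1)) - gradient f (x k)) := by
      have h := congrArg (Real.sqrt s • ·) (hv k)
      simp only [smul_inv_smul₀ hh.ne', smul_sub, smul_neg, smul_smul,
        mul_div_cancel₀ Δ₂ hh.ne'] at h
      rw [← sub_eq_zero] at h ⊢
      rw [← neg_eq_zero, ← h]
      module
    rw [hE, hE, pow_succ, mul_assoc]
    refine mul_le_mul_of_nonneg_left ?_ (by positivity)
    rw [hsqrt]
    refine one_add_mul_energy_le_of_implicit_euler_step hm hh hΔ₁ hΔ₂ hcond ?_ ?_ ?_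
    · rw [hvk, eq_sub_of_add_eq' (sub_add_cancel (x (k + 1)) (x k)), hxk]
      module
    · have h := hsc.add_inner_add_le_of_hasGradientAt (hgrad (x (k + 1))) (x k)
      rw [← neg_sub (x (k + 1)), hxk, inner_neg_right, inner_smul_right] at h
      have : 0 ≤ μ / 2 * ‖-(Real.sqrt s • v (k + 1))‖ ^ 2 := by positivity
      linarith
    · have h := hsc.add_inner_add_le_of_hasGradientAt (hgrad (x (k + 1))) xs
      rw [← neg_sub (x (k + 1)), inner_neg_right, norm_neg] at h
      rw [hmsq]
      linarith
  intro k
  have hk : (1 + Real.sqrt (μ * s)) ^ k * ((1 + Δ₁) * (f (x k) - f xs)) ≤ E 0 := by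
    refine le_trans ?_ (hanti k.zero_le)
    rw [hE k]
    gcongr
    exact le_add_of_nonneg_right (by positivity)
  have hr : 0 < (1 + Real.sqrt (μ * s)) ^ k := by positivity
  have hA : 0 < 1 + Δ₁ := by linarith
  calc f (x k) - f xs
      = 1 / (1 + Δ₁) * ((1 + Real.sqrt (μ * s)) ^ k)⁻¹ *
          ((1 + Real.sqrt (μ * s)) ^ k * ((1 + Δ₁) * (f (x k) - f xs))) := by field_simp
    _ ≤ _ := by gcongr
end
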